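/- Lemma (upper tail of the measured log-likelihood): Let ρ and σ be density matrices on ℂ^k with σ positive definite. For each n, let E^n be a PVM on (ℂ^k)^{⊗n} commuting with σ^{⊗n} and satisfying w(E^n) ≤ (n+1)^{k−1}, and let M^n be a rank-one PVM on (ℂ^k)^{⊗n} refining E^n. Then for every a > −Tr ρ log σ, P_{ρ^{⊗n}}^{M^n}{ i : −(1/n) log P_{σ^{⊗n}}^{M^n}(i) > a } → 0 as n → ∞; consequently inf{ λ : P_{ρ^{⊗n}}^{M^n}{ i : −(1/n) log P_{σ^{⊗n}}^{M^n}(i) > λ } → 0 } ≤ −Tr ρ log σ. -/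

import Mathlib

open scoped BigOperators Classical ComplexOrder
open Matrix Filter

noncomputable def matFun {d : Type*} [Fintype d] [DecidableEq d] (f : ℝ → ℝ)
    (A : Matrix d d ℂ) : Matrix d d ℂ :=
  if hA : A.IsHermitian then hA.cfc f else 0

noncomputable def matLog {d : Type*} [Fintype d] [DecidableEq d]
    (A : Matrix d d ℂ) : Matrix d d ℂ :=
  matFun Real.log A

noncomputable def tensPow {k : ℕ} (ρ : Matrix (Fin k) (Fin k) ℂ) (n : ℕ) :
    Matrix (Fin n → Fin k) (Fin n → Fin k) ℂ :=
  fun x y => ∏ i, ρ (x i) (y i)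

structure IsPVM {d ι : Type*} [Fintype d] [DecidableEq d] [Fintype ι]
    (E : ι → Matrix d d ℂ) : Prop where
  herm : ∀ i, (E i).IsHermitian
  idem : ∀ i, E i * E i = E i
  ne_zero : ∀ i, E i ≠ 0
  orth : ∀ i j, i ≠ j → E i * E j = 0
  sum_one : ∑ i, E i = 1

noncomputable def pvmWidth {d ι : Type*} [Fintype d] [DecidableEq d] [Fintype ι]
    (E : ι → Matrix d d ℂ) : ℕ :=
  Finset.univ.sup fun i => (E i).rank

def Refines {d ι κ : Type*} [Fintype d] [DecidableEq d] [Fintype ι] [Fintype κ]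
    (M : κ → Matrix d d ℂ) (E : ι → Matrix d d ℂ) : Prop :=
  ∃ f : κ → ι, ∀ i, E i = ∑ j ∈ Finset.univ.filter (fun j => f j = i), M j

def IsTest {d : Type*} [Fintype d] [DecidableEq d] (A : Matrix d d ℂ) : Prop :=
  A.PosSemidef ∧ (1 - A).PosSemidef

noncomputable def pinch {d ι : Type*} [Fintype d] [DecidableEq d] [Fintype ι]
    (E : ι → Matrix d d ℂ) (A : Matrix d d ℂ) : Matrix d d ℂ :=
  ∑ i, E i * A * E i

/-- Quantum relative entropy `D(ρ‖σ) = Tr ρ (log ρ - log σ)`. -/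
noncomputable def qRelEnt {d : Type*} [Fintype d] [DecidableEq d]
    (ρ σ : Matrix d d ℂ) : ℝ :=
  (Matrix.trace (ρ * (matLog ρ - matLog σ))).re

namespace Matrix

variable {d : Type*} [Fintype d]

theorem IsHermitian.posSemidef_of_idem {P : Matrix d d ℂ} (hP : P.IsHermitian)
    (hidem : P * P = P) : P.PosSemidef := by
  have := posSemidef_conjTranspose_mul_self P
  rwa [hP.eq, hidem] at this

variable [DecidableEq d]

/-- The trace of an idempotent matrix is its rank. -/
theorem trace_eq_rank_of_isIdempotentElem {P : Matrix d d ℂ} (hP : P * P = P) :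
    P.trace = (P.rank : ℂ) := by
  have h : IsIdempotentElem (Matrix.toLin' P) := by
    rw [IsIdempotentElem, Module.End.mul_eq_comp, ← Matrix.toLin'_mul, hP]
  rw [← Matrix.trace_toLin'_eq, (LinearMap.IsIdempotentElem.isProj_range _ h).trace, Matrix.rank]
  rfl

/-- A matrix of rank at most one is an outer product. -/
theorem exists_eq_vecMulVec_of_rank_le_one {P : Matrix d d ℂ} (hP : P.rank ≤ 1) :
    ∃ v c : d → ℂ, P = vecMulVec v c := by
  rw [Matrix.rank, finrank_le_one_iff] at hP
  obtain ⟨v, hv⟩ := hP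
  choose c hc using fun j : d => hv ⟨P.mulVecLin (Pi.single j 1), LinearMap.mem_range_self _ _⟩
  refine ⟨v, c, ?_⟩
  ext i j
  have := congrFun (congrArg Subtype.val (hc j)) i
  simp at this
  rw [vecMulVec_apply, ← this, mul_comm]

/-- Compressing by a rank-one projection multiplies it by an expectation value. -/
theorem mul_mul_self_eq_trace_smul {P : Matrix d d ℂ} (hidem : P * P = P) (hrank : P.rank = 1)
    (A : Matrix d d ℂ) : P * A * P = (P * A).trace • P := by
  obtain ⟨v, c, hvc⟩ := exists_eq_vecMulVec_of_rank_le_one hrank.le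
  have hPA : P * A * P = (c ⬝ᵥ A *ᵥ v) • P := by
    rw [hvc, vecMulVec_mul, vecMulVec_mul_vecMulVec, ← dotProduct_mulVec]
    ext i j
    simp [vecMulVec_apply]
    ring
  have htr : (P * A).trace = c ⬝ᵥ A *ᵥ v := by
    have := congrArg trace hPA
    rw [trace_mul_comm, ← mul_assoc, hidem, trace_smul, trace_eq_rank_of_isIdempotentElem hidem,
      hrank] at this
    simpa using this
  rw [hPA, htr]

theorem PosSemidef.trace_mul_re_nonneg {A B : Matrix d d ℂ} (hA : A.PosSemidef)
    (hB : B.PosSemidef) : 0 ≤ (A * B).trace.re := by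
  open scoped MatrixOrder in
  obtain ⟨C, rfl⟩ := CStarAlgebra.nonneg_iff_eq_star_mul_self.mp hB.nonneg
  rw [← mul_assoc, trace_mul_comm, ← mul_assoc, star_eq_conjTranspose]
  exact (Complex.nonneg_iff.mp (hA.mul_mul_conjTranspose_same C).trace_nonneg).1

/-- If `P Q P ≤ c P` for projections `P` and `Q`, then `P ≤ 2 c + 2 (1 - Q)`. -/
theorem posSemidef_two_smul_sub_of_compression {P Q : Matrix d d ℂ} (hP : P.IsHermitian)
    (hPP : P * P = P) (hQ : Q.IsHermitian) (hQQ : Q * Q = Q) {c : ℝ} (hc : 0 < c)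
    (h : ((c : ℂ) • P - P * Q * P).PosSemidef) :
    ((2 * c : ℂ) • (1 : Matrix d d ℂ) + (2 : ℂ) • (1 - Q) - P).PosSemidef := by
  have hcomp : ((c : ℂ) • (1 : Matrix d d ℂ) - Q * P * Q).PosSemidef := by
    have hT : (Q * P * Q).IsHermitian := by
      simp [IsHermitian, conjTranspose_mul, hQ.eq, hP.eq, mul_assoc]
    have h1 : ((c : ℂ) • (1 : Matrix d d ℂ) - Q * P * Q).IsHermitian := by
      refine IsHermitian.sub ?_ hT
      simp [IsHermitian, conjTranspose_smul]
    have h2 := posSemidef_conjTranspose_mul_self ((c : ℂ) • (1 : Matrix d d ℂ) - Q * P * Q)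
    rw [h1.eq] at h2
    have h3 := h.mul_mul_conjTranspose_same (Q * P)
    rw [conjTranspose_mul, hQ.eq, hP.eq] at h3
    have h4 := (h2.add h3).smul (a := (c : ℂ)⁻¹) (by
      rw [← Complex.ofReal_inv]; exact_mod_cast (inv_pos.mpr hc).le)
    convert h4 using 1
    have hPP' : ∀ X, P * (P * X) = P * X := fun X => by rw [← mul_assoc, hPP]
    have hQQ' : ∀ X, Q * (Q * X) = Q * X := fun X => by rw [← mul_assoc, hQQ]
    have hc' : (c : ℂ) ≠ 0 := by exact_mod_cast hc.ne'
    simp only [sub_mul, mul_sub, smul_mul_assoc, mul_smul_comm, one_mul, mul_one, mul_assoc,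
      hPP', hQQ', hPP]
    rw [eq_inv_smul_iff₀ hc']
    module
  have hflip := (hP.posSemidef_of_idem hPP).mul_mul_conjTranspose_same (Q - (1 - Q))
  have hQc : (1 - Q).IsHermitian := isHermitian_one.sub hQ
  have hPc : (1 - P).PosSemidef :=
    (isHermitian_one.sub hP).posSemidef_of_idem (by simp [mul_sub, sub_mul, hPP])
  have hbad := hPc.mul_mul_conjTranspose_same (1 - Q)
  rw [hQc.eq] at hbad
  rw [conjTranspose_sub, hQc.eq, hQ.eq] at hflip
  have h2 : (0 : ℂ) ≤ 2 := by norm_num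
  convert (hflip.add (hcomp.smul h2)).add (hbad.smul h2) using 1
  simp only [sub_mul, mul_sub, smul_sub, one_mul, mul_one, mul_assoc, hQQ, smul_smul]
  module

end Matrix

section Pinching

variable {d ι κ : Type*} [Fintype d] [DecidableEq d] [Fintype κ]
  {E : ι → Matrix d d ℂ} {M : κ → Matrix d d ℂ}

theorem IsPVM.posSemidef (hM : IsPVM M) (i : κ) : (M i).PosSemidef :=
  (hM.herm i).posSemidef_of_idem (hM.idem i)

theorem IsPVM.rank_eq_one (hM : IsPVM M) (hMw : pvmWidth M = 1) (i : κ) : (M i).rank = 1 := by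
  have h1 : (M i).rank ≤ 1 :=
    hMw ▸ Finset.le_sup (f := fun i => (M i).rank) (Finset.mem_univ i)
  have h2 : (M i).rank ≠ 0 := fun h => by
    refine hM.ne_zero i ?_
    rw [← Matrix.trace_conjTranspose_mul_self_eq_zero_iff, (hM.herm i).eq, hM.idem,
      Matrix.trace_eq_rank_of_isIdempotentElem (hM.idem i), h, Nat.cast_zero]
  omega

theorem IsPVM.sum_mul_sum (hM : IsPVM M) (s : Finset κ) :
    (∑ i ∈ s, M i) * ∑ i ∈ s, M i = ∑ i ∈ s, M i := by
  rw [Finset.sum_mul]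
  refine Finset.sum_congr rfl fun i hi => ?_
  rw [Finset.mul_sum, Finset.sum_eq_single_of_mem i hi fun j _ hj => hM.orth i j hj.symm, hM.idem]

theorem IsPVM.isHermitian_sum (hM : IsPVM M) (s : Finset κ) : (∑ i ∈ s, M i).IsHermitian := by
  simp [Matrix.IsHermitian, Matrix.conjTranspose_sum, fun i => (hM.herm i).eq]

variable {f : κ → ι}

/-- Distinct blocks of the coarser PVM do not interact through a commuting matrix. -/
theorem IsPVM.mul_mul_eq_zero (hM : IsPVM M)
    (hf : ∀ i, E i = ∑ j ∈ Finset.univ.filter (fun j => f j = i), M j)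
    {A : Matrix d d ℂ} (hEA : ∀ i, E i * A = A * E i) {i j : κ} (hij : f i ≠ f j) :
    M i * A * M j = 0 := by
  have h1 : M i = M i * E (f i) := by
    rw [hf, Finset.mul_sum, Finset.sum_eq_single_of_mem i (by simp)
      fun j _ hj => hM.orth i j hj.symm, hM.idem]
  have h2 : E (f i) * M j = 0 := by
    rw [hf, Finset.sum_mul]
    refine Finset.sum_eq_zero fun l hl => hM.orth l j ?_
    rintro rfl
    exact hij (Finset.mem_filter.mp hl).2.symm
  rw [h1, mul_assoc (M i), hEA, mul_assoc, mul_assoc, h2, mul_zero, mul_zero]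

variable [Fintype ι]

theorem IsPVM.card_fiber_le_pvmWidth (hE : IsPVM E) (hM : IsPVM M) (hMw : pvmWidth M = 1)
    (hf : ∀ i, E i = ∑ j ∈ Finset.univ.filter (fun j => f j = i), M j) (i : ι) :
    (Finset.univ.filter (fun j => f j = i)).card ≤ pvmWidth E := by
  have h := congrArg Matrix.trace (hf i)
  rw [Matrix.trace_eq_rank_of_isIdempotentElem (hE.idem i), Matrix.trace_sum] at h
  simp_rw [Matrix.trace_eq_rank_of_isIdempotentElem (hM.idem _), hM.rank_eq_one hMw] at h
  have h' : (E i).rank = (Finset.univ.filter (fun j => f j = i)).card := by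
    simp at h; exact_mod_cast h
  rw [← h']
  exact Finset.le_sup (f := fun i => (E i).rank) (Finset.mem_univ i)

/-- Pinching inequality: for a rank-one PVM refining a PVM of width at most `w` that commutes
with `A ≥ 0`, the compression of `A` to outcomes of `A`-weight at most `α` is at most `w α`. -/
theorem IsPVM.compression_le (hE : IsPVM E) (hM : IsPVM M) (hMw : pvmWidth M = 1)
    (hf : ∀ i, E i = ∑ j ∈ Finset.univ.filter (fun j => f j = i), M j)
    {A : Matrix d d ℂ} (hA : A.PosSemidef) (hEA : ∀ i, E i * A = A * E i) {w : ℕ}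
    (hw : pvmWidth E ≤ w) {α : ℝ} (s : Finset κ) (hs : ∀ i ∈ s, (M i * A).trace.re ≤ α) :
    (((w * α : ℝ) : ℂ) • (∑ i ∈ s, M i) - (∑ i ∈ s, M i) * A * ∑ i ∈ s, M i).PosSemidef := by
  have hMAM : ∀ i, M i * A * M i = (((M i * A).trace.re : ℝ) : ℂ) • M i := fun i => by
    rw [Matrix.mul_mul_self_eq_trace_smul (hM.idem i) (hM.rank_eq_one hMw i)]
    congr 1
    have h := (hA.mul_mul_conjTranspose_same (M i)).trace_nonneg
    rw [(hM.herm i).eq, Matrix.trace_mul_comm, ← mul_assoc, hM.idem] at h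
    exact Complex.eq_re_of_ofReal_le (r := 0) (by simpa using h)
  have hdiag : ∀ i, (M i * A * M i).PosSemidef := fun i => by
    have := hA.mul_mul_conjTranspose_same (M i)
    rwa [(hM.herm i).eq] at this
  have hoff : ∀ i j, (M i * A * M i + M j * A * M j - M i * A * M j - M j * A * M i).PosSemidef :=
    fun i j => by
      have := hA.mul_mul_conjTranspose_same (M i - M j)
      rw [Matrix.conjTranspose_sub, (hM.herm i).eq, (hM.herm j).eq] at this
      convert this using 1
      noncomm_ring
  have hcount : ∀ i, (s.filter fun j => f i = f j).card ≤ w := fun i => by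
    refine le_trans (Finset.card_le_card ?_)
      ((hE.card_fiber_le_pvmWidth hM hMw hf (f i)).trans hw)
    intro j hj
    simpa using (Finset.mem_filter.mp hj).2.symm
  have key : ((w * α : ℝ) : ℂ) • (∑ i ∈ s, M i) - (∑ i ∈ s, M i) * A * ∑ i ∈ s, M i
      = ∑ i ∈ s, ((w * (α - (M i * A).trace.re) : ℝ) : ℂ) • M i
        + ∑ i ∈ s, ((w - (s.filter fun j => f i = f j).card : ℝ) : ℂ) • (M i * A * M i)
        + (1 / 2 : ℂ) • ∑ i ∈ s, ∑ j ∈ s.filter (fun j => f i = f j),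
          (M i * A * M i + M j * A * M j - M i * A * M j - M j * A * M i) := by
    have hexp : (∑ i ∈ s, M i) * A * ∑ i ∈ s, M i
        = ∑ i ∈ s, ∑ j ∈ s.filter (fun j => f i = f j), M i * A * M j := by
      rw [Finset.sum_mul, Finset.sum_mul]
      refine Finset.sum_congr rfl fun i _ => ?_
      rw [Finset.mul_sum, Finset.sum_filter]
      refine Finset.sum_congr rfl fun j _ => ?_
      split_ifs with h
      · rfl
      · exact hM.mul_mul_eq_zero hf hEA h
    have hswap : ∀ g : κ → κ → Matrix d d ℂ,
        ∑ i ∈ s, ∑ j ∈ s.filter (fun j => f i = f j), g j i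
          = ∑ i ∈ s, ∑ j ∈ s.filter (fun j => f i = f j), g i j := fun g => by
      simp_rw [Finset.sum_filter]
      rw [Finset.sum_comm]
      simp_rw [eq_comm]
    have h1 : ∑ i ∈ s, ((w * α : ℝ) : ℂ) • M i
        = ∑ i ∈ s, ((w * (α - (M i * A).trace.re) : ℝ) : ℂ) • M i
          + ∑ i ∈ s, (w : ℂ) • (M i * A * M i) := by
      rw [← Finset.sum_add_distrib]
      refine Finset.sum_congr rfl fun i _ => ?_
      rw [hMAM i]
      push_cast
      module
    have h2 : ∑ i ∈ s, ((w - (s.filter fun j => f i = f j).card : ℝ) : ℂ) • (M i * A * M i)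
        = ∑ i ∈ s, (w : ℂ) • (M i * A * M i)
          - ∑ i ∈ s, ∑ j ∈ s.filter (fun j => f i = f j), M i * A * M i := by
      rw [← Finset.sum_sub_distrib]
      refine Finset.sum_congr rfl fun i _ => ?_
      rw [Finset.sum_const, ← Nat.cast_smul_eq_nsmul ℂ]
      push_cast
      module
    simp only [Finset.sum_sub_distrib, Finset.sum_add_distrib]
    rw [hswap (fun i _ => M i * A * M i), hswap (fun i j => M i * A * M j), h2, hexp,
      Finset.smul_sum, h1]
    module
  rw [key]
  refine ((Matrix.posSemidef_sum _ fun i hi => ?_).add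
    (Matrix.posSemidef_sum _ fun i _ => ?_)).add (Matrix.PosSemidef.smul
    (Matrix.posSemidef_sum _ fun i _ => Matrix.posSemidef_sum _ fun j _ => hoff i j) ?_)
  · refine (hM.posSemidef i).smul ?_
    exact_mod_cast mul_nonneg (Nat.cast_nonneg w) (sub_nonneg.mpr (hs i hi))
  · refine (hdiag i).smul ?_
    have : ((s.filter fun j => f i = f j).card : ℝ) ≤ w := by exact_mod_cast hcount i
    exact_mod_cast sub_nonneg.mpr this
  · rw [one_div, Complex.nonneg_iff]; norm_num

/-- One-shot tail bound: the weight under `R` of outcomes that are unlikely under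
`A = V diag(S) V*` is controlled by the weight under `R` of the small eigenvalues of `A`. -/
theorem IsPVM.sum_trace_le (hE : IsPVM E) (hM : IsPVM M) (hMw : pvmWidth M = 1)
    (hRef : Refines M E) {A V : Matrix d d ℂ} {S : d → ℝ} (hS : ∀ x, 0 ≤ S x)
    (hV : V * Vᴴ = 1) (hV' : Vᴴ * V = 1)
    (hAV : A = V * Matrix.diagonal (fun x => (S x : ℂ)) * Vᴴ)
    (hEA : ∀ i, E i * A = A * E i) {w : ℕ} (hw0 : 0 < w) (hw : pvmWidth E ≤ w)
    {R : Matrix d d ℂ} (hR : R.PosSemidef) (hR1 : R.trace = 1)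
    {α β : ℝ} (hα : 0 < α) (hβ : 0 < β) (s : Finset κ) (hs : ∀ i ∈ s, (M i * A).trace.re ≤ α) :
    ∑ i ∈ s, (M i * R).trace.re
      ≤ 2 * (w * α / β) + 2 * ∑ x, if S x < β then ((Vᴴ * R * V) x x).re else 0 := by
  obtain ⟨f, hf⟩ := hRef
  have hA : A.PosSemidef := by
    rw [hAV]
    exact (Matrix.PosSemidef.diagonal fun x => by
      simpa using hS x).mul_mul_conjTranspose_same V
  set P := ∑ i ∈ s, M i with hPdef
  have hP := hM.isHermitian_sum s
  have hPP := hM.sum_mul_sum s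
  set q : d → ℂ := fun x => if S x < β then 0 else 1 with hq
  set Q := V * Matrix.diagonal q * Vᴴ with hQdef
  have hQ : Q.IsHermitian := by
    have : star q = q := by
      ext x; simp only [hq, Pi.star_apply]; split_ifs <;> simp
    simp [Matrix.IsHermitian, hQdef, Matrix.conjTranspose_mul, mul_assoc,
      Matrix.diagonal_conjTranspose, this]
  have hQQ : Q * Q = Q := by
    have hqq : Matrix.diagonal q * Matrix.diagonal q = Matrix.diagonal q := by
      rw [Matrix.diagonal_mul_diagonal]
      congr 1; ext x; simp only [hq]; split_ifs <;> simp
    calc Q * Q = V * Matrix.diagonal q * (Vᴴ * V) * Matrix.diagonal q * Vᴴ := by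
          simp only [hQdef, mul_assoc]
      _ = Q := by rw [hV', mul_one, mul_assoc V, hqq]
  have hAQ : (A - (β : ℂ) • Q).PosSemidef := by
    have : A - (β : ℂ) • Q
        = V * Matrix.diagonal (fun x => ((S x - if S x < β then 0 else β : ℝ) : ℂ)) * Vᴴ := by
      rw [hAV, hQdef, ← smul_mul_assoc, ← mul_smul_comm, ← Matrix.diagonal_smul, ← sub_mul,
        ← mul_sub, Matrix.diagonal_sub]
      congr 3; ext x; simp only [hq, Pi.smul_apply]; split_ifs <;> simp
    rw [this]
    refine (Matrix.PosSemidef.diagonal fun x => ?_).mul_mul_conjTranspose_same V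
    simp only [Pi.zero_apply]
    rw [Complex.zero_le_real]
    split_ifs with h
    · simpa using hS x
    · linarith
  have hPQP : (((w * α / β : ℝ) : ℂ) • P - P * Q * P).PosSemidef := by
    have h1 := hE.compression_le hM hMw hf hA hEA hw s hs
    have h2 := hAQ.mul_mul_conjTranspose_same P
    rw [hP.eq] at h2
    have h3 := (h1.add h2).smul (a := (β : ℂ)⁻¹) (by
      rw [← Complex.ofReal_inv]; exact_mod_cast (inv_pos.mpr hβ).le)
    convert h3 using 1
    have hβ' : (β : ℂ) ≠ 0 := by exact_mod_cast hβ.ne'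
    rw [eq_inv_smul_iff₀ hβ', smul_sub, smul_smul]
    have : (β : ℂ) * ((w * α / β : ℝ) : ℂ) = ((w * α : ℝ) : ℂ) := by
      push_cast; field_simp
    rw [this, mul_sub, sub_mul, mul_smul_comm, smul_mul_assoc]
    abel
  have hmain := (Matrix.posSemidef_two_smul_sub_of_compression hP hPP hQ hQQ
    (by positivity) hPQP).trace_mul_re_nonneg hR
  have hQc : ((1 - Q) * R).trace.re
      = ∑ x, if S x < β then ((Vᴴ * R * V) x x).re else 0 := by
    have h1 : 1 - Q = V * Matrix.diagonal (1 - q) * Vᴴ := by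
      have h : Matrix.diagonal (1 - q) = 1 - Matrix.diagonal q := by
        rw [← Matrix.diagonal_one, Matrix.diagonal_sub]
        rfl
      rw [hQdef, h, mul_sub, sub_mul, mul_one, hV]
    rw [h1, mul_assoc, mul_assoc, Matrix.trace_mul_comm, mul_assoc, Matrix.trace, Complex.re_sum]
    refine Finset.sum_congr rfl fun x _ => ?_
    rw [Matrix.diag_apply, Matrix.diagonal_mul]
    simp only [hq, Pi.sub_apply, Pi.one_apply]
    split_ifs <;> simp
  rw [← hQc]
  have hPR : ∑ i ∈ s, (M i * R).trace.re = (P * R).trace.re := by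
    rw [hPdef, Finset.sum_mul, Matrix.trace_sum, Complex.re_sum]
  rw [hPR]
  rw [sub_mul, add_mul, smul_mul_assoc, smul_mul_assoc, Matrix.trace_sub, Matrix.trace_add,
    Matrix.trace_smul, Matrix.trace_smul, one_mul, hR1, Complex.sub_re, Complex.add_re] at hmain
  have h2 : ((2 : ℂ) • ((1 - Q) * R).trace).re = 2 * ((1 - Q) * R).trace.re := by
    simp
  have h3 : (((2 : ℂ) * ((w * α / β : ℝ) : ℂ)) • (1 : ℂ)).re = 2 * (w * α / β) := by
    rw [smul_eq_mul, mul_one, ← Complex.ofReal_ofNat, ← Complex.ofReal_mul, Complex.ofReal_re]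
  rw [h2, h3] at hmain
  linarith

end Pinching

section TensorPower

variable {k : ℕ}

theorem tensPow_mul (A B : Matrix (Fin k) (Fin k) ℂ) (n : ℕ) :
    tensPow (A * B) n = tensPow A n * tensPow B n := by
  ext x y
  simp only [tensPow, Matrix.mul_apply, Fintype.prod_sum, Finset.prod_mul_distrib]

theorem tensPow_conjTranspose (A : Matrix (Fin k) (Fin k) ℂ) (n : ℕ) :
    tensPow Aᴴ n = (tensPow A n)ᴴ := by
  ext x y
  simp [tensPow, Matrix.conjTranspose_apply]

theorem tensPow_diagonal (s : Fin k → ℂ) (n : ℕ) :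
    tensPow (Matrix.diagonal s) n = Matrix.diagonal fun x => ∏ i, s (x i) := by
  ext x y
  by_cases h : x = y
  · subst h; simp [tensPow]
  · obtain ⟨i, hi⟩ := Function.ne_iff.mp h
    rw [Matrix.diagonal_apply_ne _ h]
    exact Finset.prod_eq_zero (Finset.mem_univ i) (Matrix.diagonal_apply_ne _ hi)

theorem tensPow_one (n : ℕ) : tensPow (1 : Matrix (Fin k) (Fin k) ℂ) n = 1 := by
  rw [← Matrix.diagonal_one, tensPow_diagonal]
  simp

theorem tensPow_trace (A : Matrix (Fin k) (Fin k) ℂ) (n : ℕ) :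
    (tensPow A n).trace = A.trace ^ n := by
  simp [Matrix.trace, tensPow, Finset.sum_pow']

theorem tensPow_posSemidef {A : Matrix (Fin k) (Fin k) ℂ} (hA : A.PosSemidef) (n : ℕ) :
    (tensPow A n).PosSemidef := by
  open scoped MatrixOrder in
  obtain ⟨C, rfl⟩ := CStarAlgebra.nonneg_iff_eq_star_mul_self.mp hA.nonneg
  rw [Matrix.star_eq_conjTranspose, tensPow_mul, tensPow_conjTranspose]
  exact Matrix.posSemidef_conjTranspose_mul_self _

end TensorPower

/-- Chernoff bound for the lower tail of a product of independent positive variables. -/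
theorem sum_prod_ite_le_pow {ι : Type*} [Fintype ι] {p s : ι → ℝ} (hp : ∀ x, 0 ≤ p x)
    (hs : ∀ x, 0 < s x) {b t : ℝ} (ht : 0 ≤ t) (n : ℕ) :
    (∑ x : Fin n → ι, if ∏ i, s (x i) < Real.exp (-(n * b)) then ∏ i, p (x i) else 0)
      ≤ (∑ j, p j * Real.exp (-t * (b + Real.log (s j)))) ^ n := by
  rw [Finset.sum_pow', Fintype.piFinset_univ]
  refine Finset.sum_le_sum fun x _ => ?_
  rw [Finset.prod_mul_distrib, ← Real.exp_sum]
  have hp' : 0 ≤ ∏ i, p (x i) := Finset.prod_nonneg fun i _ => hp _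
  split_ifs with h
  · refine le_mul_of_one_le_right hp' (Real.one_le_exp ?_)
    have hlog := Real.log_lt_log (Finset.prod_pos fun i _ => hs (x i)) h
    rw [Real.log_exp, Real.log_prod fun i _ => (hs (x i)).ne'] at hlog
    rw [← Finset.mul_sum, Finset.sum_add_distrib]
    simp only [Finset.sum_const, Finset.card_univ, Fintype.card_fin, nsmul_eq_mul]
    nlinarith
  · positivity

/-- A strict inequality on the mean gives an exponentially small moment bound. -/
theorem exists_pos_sum_mul_exp_lt_one {ι : Type*} [Fintype ι] {p l : ι → ℝ} {b : ℝ}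
    (hp1 : ∑ x, p x = 1) (hb : -∑ x, p x * l x < b) :
    ∃ t > 0, ∑ x, p x * Real.exp (-t * (b + l x)) < 1 := by
  have hd : HasDerivAt (fun t : ℝ => ∑ x, p x * Real.exp (-t * (b + l x)))
      (∑ x, p x * (-(b + l x))) 0 := by
    refine HasDerivAt.fun_sum fun x _ => ?_
    have h1 : HasDerivAt (fun t : ℝ => -t * (b + l x)) (-1 * (b + l x)) 0 :=
      (hasDerivAt_neg 0).mul_const _
    have := (h1.exp).const_mul (p x)
    simpa using this
  have hneg : ∑ x, p x * (-(b + l x)) < 0 := by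
    have : ∑ x, p x * (-(b + l x)) = -(b * ∑ x, p x) - ∑ x, p x * l x := by
      rw [Finset.mul_sum, ← Finset.sum_neg_distrib, ← Finset.sum_sub_distrib]
      exact Finset.sum_congr rfl fun x _ => by ring
    rw [this, hp1]
    linarith
  have hev := hd.hasDerivWithinAt (s := Set.Ioi 0) |>.limsup_slope_le' (by simp) hneg
  obtain ⟨t, ht, ht0⟩ := (hev.and self_mem_nhdsWithin).exists
  refine ⟨t, ht0, ?_⟩
  rw [slope_def_field, div_neg_iff] at ht
  have ht0' : (0 : ℝ) < t := ht0
  simp [hp1] at ht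
  rcases ht with h | h
  · linarith [h.2]
  · simpa using h.1

theorem tendsto_succ_pow_mul_exp_neg (m : ℕ) {c : ℝ} (hc : 0 < c) :
    Tendsto (fun n : ℕ => ((n : ℝ) + 1) ^ m * Real.exp (-(n * c))) atTop (nhds 0) := by
  have h1 : Tendsto (fun n : ℕ => (((n + 1 : ℕ) : ℝ) ^ m * Real.exp (-c) ^ (n + 1)))
      atTop (nhds 0) :=
    (tendsto_pow_const_mul_const_pow_of_abs_lt_one m
      (by rw [abs_of_pos (Real.exp_pos _)]; exact Real.exp_lt_one_iff.mpr (by linarith))).comp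
      (tendsto_add_atTop_nat 1)
  have h2 := h1.mul_const (Real.exp c)
  rw [zero_mul] at h2
  refine h2.congr fun n => ?_
  rw [mul_assoc, ← Real.exp_nat_mul, ← Real.exp_add]
  push_cast
  ring_nf

/-- Diagonalization of a positive definite `σ` of trace one, with the induced probability vector
of a density matrix `ρ` and its log-likelihood. -/
theorem exists_diagonalization {k : ℕ} {ρ σ : Matrix (Fin k) (Fin k) ℂ}
    (hρ : ρ.PosSemidef) (hρ1 : ρ.trace = 1) (hσ : σ.PosDef) (hσ1 : σ.trace = 1) :
    ∃ (U : Matrix (Fin k) (Fin k) ℂ) (s p : Fin k → ℝ), U * Uᴴ = 1 ∧ Uᴴ * U = 1 ∧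
      (∀ x, 0 < s x) ∧ (∀ x, s x ≤ 1) ∧ (∀ x, 0 ≤ p x) ∧ ∑ x, p x = 1 ∧
      σ = U * Matrix.diagonal (fun x => (s x : ℂ)) * Uᴴ ∧
      (∀ x, (Uᴴ * ρ * U) x x = p x) ∧
      (ρ * matLog σ).trace.re = ∑ x, p x * Real.log (s x) := by
  have hH := hσ.isHermitian
  set U : Matrix (Fin k) (Fin k) ℂ := hH.eigenvectorUnitary.1
  have hUU : U * Uᴴ = 1 := Unitary.mul_star_self_of_mem hH.eigenvectorUnitary.2
  have hUU' : Uᴴ * U = 1 := Unitary.star_mul_self_of_mem hH.eigenvectorUnitary.2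
  have hs := hσ.eigenvalues_pos
  have hsum : ∑ x, hH.eigenvalues x = 1 := by
    have := hH.trace_eq_sum_eigenvalues
    rw [hσ1] at this
    simpa using (congrArg Complex.re this).symm
  have hpsd := hρ.conjTranspose_mul_mul_same U
  have hp : ∀ x, (Uᴴ * ρ * U) x x = ((Uᴴ * ρ * U) x x).re := fun x =>
    Complex.eq_re_of_ofReal_le (r := 0) (by simpa using hpsd.diag_nonneg (i := x))
  refine ⟨U, hH.eigenvalues, fun x => ((Uᴴ * ρ * U) x x).re, hUU, hUU', hs, fun x => ?_,
    fun x => (Complex.nonneg_iff.mp hpsd.diag_nonneg).1, ?_, ?_, hp, ?_⟩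
  · rw [← hsum]
    exact Finset.single_le_sum (fun y _ => (hs y).le) (Finset.mem_univ x)
  · have h : (Uᴴ * ρ * U).trace = 1 := by
      rw [Matrix.trace_mul_comm, ← mul_assoc, hUU, one_mul, hρ1]
    rw [← Complex.re_sum]
    exact congrArg Complex.re h
  · exact hH.spectral_theorem
  · have hlog : matLog σ
        = U * Matrix.diagonal (fun x => (Real.log (hH.eigenvalues x) : ℂ)) * Uᴴ := by
      rw [matLog, matFun, dif_pos hH]
      rfl
    rw [hlog, ← mul_assoc, Matrix.trace_mul_comm, ← mul_assoc, ← mul_assoc, Matrix.trace,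
      Complex.re_sum]
    refine Finset.sum_congr rfl fun x _ => ?_
    rw [Matrix.diag_apply, Matrix.mul_diagonal, Complex.re_mul_ofReal]

/-- **Upper tail of the measured log-likelihood (Lemma in section 7).**
For PVMs `E n` commuting with `σ^{⊗n}` with `w(E n) ≤ (n+1)^(k-1)` and rank-one PVMs
`M n` refining `E n`, for every `a > -Tr ρ log σ` the `P_{ρ^{⊗n}}^{M^n}`-probability
that `-(1/n) log P_{σ^{⊗n}}^{M^n} > a` tends to `0`; consequently
`inf {λ | that probability at level λ tends to 0} ≤ -Tr ρ log σ`. -/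
theorem stmt_4 (k : ℕ) (ρ σ : Matrix (Fin k) (Fin k) ℂ)
    (hρ : ρ.PosSemidef) (hρ1 : ρ.trace = 1)
    (hσ : σ.PosDef) (hσ1 : σ.trace = 1)
    (ιE ιM : ℕ → Type) [∀ n, Fintype (ιE n)] [∀ n, Fintype (ιM n)]
    (E : ∀ n : ℕ, ιE n → Matrix (Fin n → Fin k) (Fin n → Fin k) ℂ)
    (M : ∀ n : ℕ, ιM n → Matrix (Fin n → Fin k) (Fin n → Fin k) ℂ)
    (hE : ∀ n, IsPVM (E n))
    (hEσ : ∀ n i, E n i * tensPow σ n = tensPow σ n * E n i)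
    (hew : ∀ n, pvmWidth (E n) ≤ (n + 1) ^ (k - 1))
    (hM : ∀ n, IsPVM (M n))
    (hMrank : ∀ n, pvmWidth (M n) = 1)
    (hRef : ∀ n, Refines (M n) (E n)) :
    (∀ a : ℝ, -(Matrix.trace (ρ * matLog σ)).re < a →
      Filter.Tendsto
        (fun n : ℕ => ∑ i ∈ Finset.univ.filter (fun i : ιM n =>
            a < -(1 / (n : ℝ)) * Real.log (Matrix.trace (M n i * tensPow σ n)).re),
          (Matrix.trace (M n i * tensPow ρ n)).re)
        Filter.atTop (nhds 0)) ∧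
    sInf {lam : ℝ | Filter.Tendsto
        (fun n : ℕ => ∑ i ∈ Finset.univ.filter (fun i : ιM n =>
            lam < -(1 / (n : ℝ)) * Real.log (Matrix.trace (M n i * tensPow σ n)).re),
          (Matrix.trace (M n i * tensPow ρ n)).re)
        Filter.atTop (nhds 0)}
      ≤ -(Matrix.trace (ρ * matLog σ)).re := by
  obtain ⟨U, s, p, hUU, hUU', hs, hs1, hp, hp1, hσU, hρU, htr⟩ :=
    exists_diagonalization hρ hρ1 hσ hσ1
  have hVV : ∀ n, tensPow U n * (tensPow U n)ᴴ = 1 := fun n => by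
    rw [← tensPow_conjTranspose, ← tensPow_mul, hUU, tensPow_one]
  have hVV' : ∀ n, (tensPow U n)ᴴ * tensPow U n = 1 := fun n => by
    rw [← tensPow_conjTranspose, ← tensPow_mul, hUU', tensPow_one]
  have hσV : ∀ n, tensPow σ n = tensPow U n *
      Matrix.diagonal (fun x => ((∏ i, s (x i) : ℝ) : ℂ)) * (tensPow U n)ᴴ := fun n => by
    conv_lhs => rw [hσU, tensPow_mul, tensPow_mul, tensPow_diagonal, tensPow_conjTranspose]
    simp
  have hρV : ∀ n x, (((tensPow U n)ᴴ * tensPow ρ n * tensPow U n) x x).re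
      = ∏ i, p (x i) := fun n x => by
    rw [← tensPow_conjTranspose, ← tensPow_mul, ← tensPow_mul, tensPow]
    simp_rw [hρU]
    rw [← Complex.ofReal_prod, Complex.ofReal_re]
  have htail : ∀ a : ℝ, -(Matrix.trace (ρ * matLog σ)).re < a →
      Filter.Tendsto
        (fun n : ℕ => ∑ i ∈ Finset.univ.filter (fun i : ιM n =>
            a < -(1 / (n : ℝ)) * Real.log (Matrix.trace (M n i * tensPow σ n)).re),
          (Matrix.trace (M n i * tensPow ρ n)).re)
        Filter.atTop (nhds 0) := by
    intro a ha
    obtain ⟨b, hb, hba⟩ := exists_between ha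
    rw [htr] at hb
    obtain ⟨t, ht, hF⟩ := exists_pos_sum_mul_exp_lt_one hp1 hb
    set F := ∑ x, p x * Real.exp (-t * (b + Real.log (s x))) with hFdef
    have hF0 : 0 ≤ F := Finset.sum_nonneg fun x _ => mul_nonneg (hp x) (Real.exp_pos _).le
    have hlim : Tendsto (fun n : ℕ => 2 * (((n : ℝ) + 1) ^ (k - 1) * Real.exp (-(n * (a - b))))
        + 2 * F ^ n) atTop (nhds 0) := by
      simpa using ((tendsto_succ_pow_mul_exp_neg (k - 1) (sub_pos.mpr hba)).const_mul 2).add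
        ((tendsto_pow_atTop_nhds_zero_of_lt_one hF0 hF).const_mul 2)
    refine tendsto_of_tendsto_of_tendsto_of_le_of_le' tendsto_const_nhds hlim
      (Eventually.of_forall fun n => Finset.sum_nonneg fun i _ =>
        ((hM n).posSemidef i).trace_mul_re_nonneg (tensPow_posSemidef hρ n)) ?_
    filter_upwards [eventually_gt_atTop 0] with n hn
    have hn' : (0 : ℝ) < n := by exact_mod_cast hn
    refine ((hE n).sum_trace_le (hM n) (hMrank n) (hRef n)
      (fun x => Finset.prod_nonneg fun i _ => (hs (x i)).le) (hVV n) (hVV' n) (hσV n) (hEσ n)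
      (by positivity) (hew n) (tensPow_posSemidef hρ n) (by rw [tensPow_trace, hρ1, one_pow])
      (Real.exp_pos (-(n * a))) (Real.exp_pos (-(n * b))) _ fun i hi => ?_).trans ?_
    · have hi := (Finset.mem_filter.mp hi).2
      by_contra! hq
      have hlog := Real.log_lt_log (Real.exp_pos _) hq
      rw [Real.log_exp] at hlog
      rw [neg_mul, one_div, inv_mul_eq_div, ← neg_div, lt_div_iff₀ hn'] at hi
      linarith
    · simp_rw [hρV]
      refine add_le_add (le_of_eq ?_) (mul_le_mul_of_nonneg_left
        (sum_prod_ite_le_pow hp hs ht.le n) zero_le_two)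
      rw [mul_div_assoc, ← Real.exp_sub]
      push_cast
      ring_nf
  refine ⟨htail, ?_⟩
  set S := {lam : ℝ | Filter.Tendsto
        (fun n : ℕ => ∑ i ∈ Finset.univ.filter (fun i : ιM n =>
            lam < -(1 / (n : ℝ)) * Real.log (Matrix.trace (M n i * tensPow σ n)).re),
          (Matrix.trace (M n i * tensPow ρ n)).re)
        Filter.atTop (nhds 0)} with hSdef
  by_cases hS : BddBelow S
  · exact le_of_forall_gt_imp_ge_of_dense fun a ha => csInf_le hS (htail a ha)
  · rw [Real.sInf_of_not_bddBelow hS, htr, Left.nonneg_neg_iff]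
    exact Finset.sum_nonpos fun x _ =>
      mul_nonpos_of_nonneg_of_nonpos (hp x) (Real.log_nonpos (hs x).le (hs1 x))
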